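/- (Fast rate for the truncated class, upper bound) Let d ≥ 1 and K ≥ 1 be integers, 0 < h ≤ 1, 0 < a ≤ 1 ≤ A < ∞, and let w_K(j) = 2^{dj} for j ≤ K and w_K(j) = 2^{dK} for j > K; let P_K^(d) = P_{w_K,h,a,A}. Then there exist a constant C > 0 depending only on K, d, h, a, A and a sequence of frequency ranks (J_n) such that for every n ≥ 3, sup over π ∈ P_K^(d) of E_{π^⊗n}[R(f̂_n^{(J_n)}) − R(f*)] ≤ C · (log n)/n, where f̂_n^{(J_n)} is the dyadic majority-vote classifier built from an i.i.d. sample of size n from π. -/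

import Mathlib

open MeasureTheory Set
open scoped ENNReal

noncomputable section

/-- Points of `ℝ^d`. -/
abbrev Pt (d : ℕ) : Type := Fin d → ℝ

/-- The unit cube `[0,1]^d`. -/
def unitCube (d : ℕ) : Set (Pt d) := Set.Icc 0 1

/-- Lebesgue measure `λ_d` on `[0,1]^d`. -/
def lamd (d : ℕ) : Measure (Pt d) := volume.restrict (unitCube d)

/-- The dyadic subinterval of `[0,1]` at level `j` with index `k`:
`[k 2^{-j}, (k+1) 2^{-j})` for `k < 2^j - 1` and `[1 - 2^{-j}, 1]` for `k = 2^j - 1`. -/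
def dyadicI (j k : ℕ) : Set ℝ :=
  if k = 2 ^ j - 1 then Set.Icc (1 - ((2 : ℝ) ^ j)⁻¹) 1
  else Set.Ico ((k : ℝ) / 2 ^ j) (((k : ℝ) + 1) / 2 ^ j)

/-- The dyadic cube `I_k^{(j)} ⊆ [0,1]^d` at level `j` with multi-index `k`. -/
def dyadicCube (d j : ℕ) (k : Fin d → ℕ) : Set (Pt d) :=
  {x | ∀ i, x i ∈ dyadicI j (k i)}

/-- `f` is represented by the (automatically countable) family `T` of pairwise disjoint
dyadic cubes whose union has full Lebesgue measure in `[0,1]^d`, with `f` constant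
on each cube of the family. -/
def IsDyadicRep (d : ℕ) (f : Pt d → ℝ) (T : Set (ℕ × (Fin d → ℕ))) : Prop :=
  (∀ p ∈ T, ∀ i, p.2 i < 2 ^ p.1) ∧
  (T.PairwiseDisjoint fun p => dyadicCube d p.1 p.2) ∧
  lamd d (unitCube d \ ⋃ p ∈ T, dyadicCube d p.1 p.2) = 0 ∧
  (∀ p ∈ T, ∀ x ∈ dyadicCube d p.1 p.2, ∀ y ∈ dyadicCube d p.1 p.2, f x = f y)

/-- The class `F^(d)` of measurable `{-1,1}`-valued functions admitting a dyadic
representation. -/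
def memF (d : ℕ) (f : Pt d → ℝ) : Prop :=
  Measurable f ∧ (∀ x, f x = 1 ∨ f x = -1) ∧ ∃ T, IsDyadicRep d f T

/-- The class `F_w^(d)`: a dyadic representation with at most `w j` cubes of side
`2^{-j}` for every level `j`. -/
def memFw (d : ℕ) (w : ℕ → ℝ) (f : Pt d → ℝ) : Prop :=
  Measurable f ∧ (∀ x, f x = 1 ∨ f x = -1) ∧
    ∃ T, IsDyadicRep d f T ∧
      ∀ j, ((T ∩ {p | p.1 = j}).encard : ℝ≥0∞) ≤ ENNReal.ofReal (w j)

/-- Marginal `P^X` of `π` on `[0,1]^d`. -/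
def margX {d : ℕ} (π : Measure (Pt d × ℝ)) : Measure (Pt d) := π.map Prod.fst

/-- The labels of `π` lie in `{-1, 1}` almost surely. -/
def Labels {d : ℕ} (π : Measure (Pt d × ℝ)) : Prop := π {p | p.2 = 1 ∨ p.2 = -1} = 1

/-- `η` is the regression function (conditional probability of `Y = 1`) of `π`. -/
def IsRegression {d : ℕ} (π : Measure (Pt d × ℝ)) (η : Pt d → ℝ) : Prop :=
  Measurable η ∧ (∀ x, η x ∈ Set.Icc (0 : ℝ) 1) ∧
    ∀ s : Set (Pt d), MeasurableSet s →
      π (s ×ˢ {(1 : ℝ)}) = ∫⁻ x in s, ENNReal.ofReal (η x) ∂(margX π)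

/-- The Bayes rule `f*` associated with the regression function `η`. -/
def bayes {d : ℕ} (η : Pt d → ℝ) (x : Pt d) : ℝ := if 1 / 2 ≤ η x then 1 else -1

/-- Misclassification risk `R(f) = π({(x,y) : f(x) ≠ y})`. -/
def risk {d : ℕ} (π : Measure (Pt d × ℝ)) (f : Pt d → ℝ) : ℝ :=
  (π {p | f p.1 ≠ p.2}).toReal

/-- Assumption (A1): `P^X` is absolutely continuous w.r.t. `λ_d` with density
between `a` and `A`. -/
def A1cond {d : ℕ} (π : Measure (Pt d × ℝ)) (a A : ℝ) : Prop :=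
  ∀ s : Set (Pt d), MeasurableSet s →
    ENNReal.ofReal a * lamd d s ≤ margX π s ∧ margX π s ≤ ENNReal.ofReal A * lamd d s

/-- Strong margin assumption (SMA) with margin `h`. -/
def SMAcond {d : ℕ} (π : Measure (Pt d × ℝ)) (η : Pt d → ℝ) (h : ℝ) : Prop :=
  margX π {x | h ≤ |2 * η x - 1|} = 1

/-- Number of indices `i` satisfying `P i`. -/
def cnt (n : ℕ) (P : Fin n → Prop) : ℕ := Nat.card {i // P i}

/-- Index of the level-`J` dyadic interval containing `t ∈ [0,1]`. -/
def dyadicIdx (J : ℕ) (t : ℝ) : ℕ := min ⌊t * 2 ^ J⌋₊ (2 ^ J - 1)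

/-- The level-`J` dyadic cube containing `x ∈ [0,1]^d`. -/
def cubeOf (d J : ℕ) (x : Pt d) : Set (Pt d) := dyadicCube d J fun i => dyadicIdx J (x i)

open Classical in
/-- The dyadic majority-vote classifier `f̂_n^{(J)}` built from the sample `s`. -/
def fhat (d J n : ℕ) (s : Fin n → Pt d × ℝ) (x : Pt d) : ℝ :=
  if (∃ i, (s i).1 ∈ cubeOf d J x) ∧
      cnt n (fun i => (s i).1 ∈ cubeOf d J x ∧ (s i).2 = -1) <
        cnt n (fun i => (s i).1 ∈ cubeOf d J x ∧ (s i).2 = 1)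
  then 1 else -1

/-- The `n`-fold product measure `π^{⊗n}` governing the i.i.d. sample. -/
def sampM {d : ℕ} (π : Measure (Pt d × ℝ)) [SigmaFinite π] (n : ℕ) :
    Measure (Fin n → Pt d × ℝ) := Measure.pi fun _ => π

/-- Expected excess risk `E_{π^{⊗n}}[R(f̂_n) - R(f*)]` of the classifier `F`. -/
def excessExp {d : ℕ} (π : Measure (Pt d × ℝ)) [SigmaFinite π] (η : Pt d → ℝ) (n : ℕ)
    (F : (Fin n → Pt d × ℝ) → Pt d → ℝ) : ℝ :=
  ∫ s, risk π (F s) ∂(sampM π n) - risk π (bayes η)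

/-- The class `P_{w,h,a,A}` of probability measures (together with their regression
functions) satisfying (A1), (SMA), and whose Bayes rule belongs to `F_w^(d)`. -/
def Pclass (d : ℕ) (w : ℕ → ℝ) (h a A : ℝ) :
    Set (ProbabilityMeasure (Pt d × ℝ) × (Pt d → ℝ)) :=
  {p | Labels (p.1 : Measure (Pt d × ℝ)) ∧ IsRegression (p.1 : Measure (Pt d × ℝ)) p.2 ∧
       A1cond (p.1 : Measure (Pt d × ℝ)) a A ∧ SMAcond (p.1 : Measure (Pt d × ℝ)) p.2 h ∧
       memFw d w (bayes p.2)}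

end

/-! ### Dyadic geometry -/

lemma mem_dyadicI_iff {j k : ℕ} (hk : k < 2 ^ j) (t : ℝ) :
    t ∈ dyadicI j k ↔ t ∈ Icc (0 : ℝ) 1 ∧ dyadicIdx j t = k := by
  have hN : (0 : ℝ) < 2 ^ j := by positivity
  have hN1 : (1 : ℝ) ≤ 2 ^ j := one_le_pow₀ (by norm_num)
  have hinv : (0 : ℝ) ≤ 1 - ((2 : ℝ) ^ j)⁻¹ := sub_nonneg.2 (inv_le_one_of_one_le₀ hN1)
  have hmul : ((2 : ℝ) ^ j)⁻¹ * 2 ^ j = 1 := inv_mul_cancel₀ hN.ne'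
  unfold dyadicI dyadicIdx
  split_ifs with h
  · subst h
    have hcast : ((2 ^ j - 1 : ℕ) : ℝ) = 2 ^ j - 1 := by
      rw [Nat.cast_sub Nat.one_le_two_pow]
      push_cast
      rfl
    rw [min_eq_right_iff, mem_Icc, mem_Icc]
    constructor
    · rintro ⟨h1, h2⟩
      refine ⟨⟨hinv.trans h1, h2⟩, Nat.le_floor ?_⟩
      rw [hcast]
      nlinarith
    · rintro ⟨⟨h0, h1⟩, h2⟩
      have h3 := (Nat.le_floor_iff (by positivity)).1 h2
      rw [hcast] at h3
      refine ⟨?_, h1⟩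
      by_contra! h4
      nlinarith
  · have hk' : k < 2 ^ j - 1 := by omega
    have hk1 : (k : ℝ) + 1 ≤ 2 ^ j := by exact_mod_cast hk
    have hmin : min ⌊t * 2 ^ j⌋₊ (2 ^ j - 1) = k ↔ ⌊t * 2 ^ j⌋₊ = k := by omega
    rw [hmin, mem_Ico, mem_Icc, div_le_iff₀ hN, lt_div_iff₀ hN]
    constructor
    · rintro ⟨h1, h2⟩
      have h0 : 0 ≤ t * 2 ^ j := (Nat.cast_nonneg k).trans h1
      refine ⟨⟨nonneg_of_mul_nonneg_left h0 hN, ?_⟩, (Nat.floor_eq_iff h0).2 ⟨h1, h2⟩⟩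
      by_contra! h3
      nlinarith
    · rintro ⟨⟨h0, -⟩, h2⟩
      exact (Nat.floor_eq_iff (by positivity)).1 h2

lemma dyadicIdx_lt (j : ℕ) (t : ℝ) : dyadicIdx j t < 2 ^ j :=
  (min_le_right _ _).trans_lt (Nat.sub_lt (by positivity) one_pos)

lemma dyadicIdx_eq_div {j J : ℕ} (hjJ : j ≤ J) (t : ℝ) :
    dyadicIdx j t = dyadicIdx J t / 2 ^ (J - j) := by
  obtain ⟨m, rfl⟩ := Nat.exists_eq_add_of_le hjJ
  have hm : Monotone fun a : ℕ => a / 2 ^ m := fun a b hab => Nat.div_le_div_right hab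
  have hfl : ⌊t * 2 ^ j⌋₊ = ⌊t * 2 ^ (j + m)⌋₊ / 2 ^ m := by
    rw [← Nat.floor_div_natCast]
    congr 1
    push_cast
    rw [pow_add]
    field_simp
  have hpred : 2 ^ j - 1 = (2 ^ (j + m) - 1) / 2 ^ m := by
    symm
    rw [Nat.div_eq_iff (by positivity), pow_add]
    obtain ⟨a, ha⟩ : ∃ a, 2 ^ j = a + 1 := Nat.exists_eq_succ_of_ne_zero (by positivity)
    have hb : 0 < 2 ^ m := by positivity
    rw [ha, add_mul]
    simp only [add_tsub_cancel_right]
    omega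
  rw [Nat.add_sub_cancel_left]
  unfold dyadicIdx
  rw [hfl, hpred]
  exact (hm.map_min (a := ⌊t * 2 ^ (j + m)⌋₊) (b := 2 ^ (j + m) - 1)).symm

lemma mem_dyadicCube_iff {d j : ℕ} {k : Fin d → ℕ} (hk : ∀ i, k i < 2 ^ j) (x : Pt d) :
    x ∈ dyadicCube d j k ↔ x ∈ unitCube d ∧ ∀ i, dyadicIdx j (x i) = k i := by
  simp only [dyadicCube, mem_ofPred_eq, mem_dyadicI_iff (hk _), forall_and, unitCube, mem_Icc,
    Pi.le_def, Pi.zero_apply, Pi.one_apply]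

/-- A dyadic cube which meets a dyadic cube of a coarser level is contained in it. -/
lemma dyadicCube_subset {d j J : ℕ} (hjJ : j ≤ J) {k l : Fin d → ℕ} (hk : ∀ i, k i < 2 ^ j)
    (hl : ∀ i, l i < 2 ^ J) {x : Pt d} (hxk : x ∈ dyadicCube d j k)
    (hxl : x ∈ dyadicCube d J l) : dyadicCube d J l ⊆ dyadicCube d j k := by
  intro y hy
  rw [mem_dyadicCube_iff hl] at hxl hy
  rw [mem_dyadicCube_iff hk] at hxk ⊢
  refine ⟨hy.1, fun i => ?_⟩
  rw [← hxk.2 i, dyadicIdx_eq_div hjJ, dyadicIdx_eq_div hjJ, hy.2, hxl.2]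

lemma cubeOf_eq {d J : ℕ} {k : Fin d → ℕ} (hk : ∀ i, k i < 2 ^ J) {x : Pt d}
    (hx : x ∈ dyadicCube d J k) : cubeOf d J x = dyadicCube d J k := by
  rw [cubeOf, funext ((mem_dyadicCube_iff hk x).1 hx).2]

lemma measurableSet_dyadicCube (d j : ℕ) (k : Fin d → ℕ) :
    MeasurableSet (dyadicCube d j k) := by
  have : dyadicCube d j k = univ.pi fun i => dyadicI j (k i) := by
    ext x
    simp [dyadicCube]
  rw [this]
  refine MeasurableSet.univ_pi fun i => ?_
  unfold dyadicI
  split_ifs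
  exacts [measurableSet_Icc, measurableSet_Ico]

lemma volume_dyadicI (j k : ℕ) : volume (dyadicI j k) = 2⁻¹ ^ j := by
  have h2 : ENNReal.ofReal ((2 : ℝ) ^ j)⁻¹ = 2⁻¹ ^ j := by
    rw [ENNReal.ofReal_inv_of_pos (by positivity), ENNReal.ofReal_pow (by norm_num),
      ENNReal.inv_pow]
    norm_num
  unfold dyadicI
  split_ifs
  · rw [Real.volume_Icc, ← h2]
    ring_nf
  · rw [Real.volume_Ico, ← h2]
    ring_nf

lemma lamd_dyadicCube {d j : ℕ} {k : Fin d → ℕ} (hk : ∀ i, k i < 2 ^ j) :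
    lamd d (dyadicCube d j k) = 2⁻¹ ^ (d * j) := by
  have hsub : dyadicCube d j k ⊆ unitCube d := fun x hx => ((mem_dyadicCube_iff hk x).1 hx).1
  have hpi : dyadicCube d j k = univ.pi fun i => dyadicI j (k i) := by
    ext x
    simp [dyadicCube]
  rw [lamd, Measure.restrict_eq_self _ hsub, hpi, volume_pi_pi]
  simp [volume_dyadicI, ← pow_mul, mul_comm]

/-- If at most `2 ^ (d * K)` cubes of each level belong to `T`, the cubes of level exceeding `J`
cover a set of Lebesgue measure at most `2 ^ (d * K) / 2 ^ (d * J)`. -/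
lemma lamd_fine_cubes_le {d K : ℕ} (hd : 1 ≤ d) {T : Set (ℕ × (Fin d → ℕ))}
    (hT : ∀ p ∈ T, ∀ i, p.2 i < 2 ^ p.1)
    (hcard : ∀ j, ((T ∩ {p | p.1 = j}).encard : ℝ≥0∞) ≤ 2 ^ (d * K)) (J : ℕ) :
    lamd d (⋃ p ∈ {p ∈ T | J < p.1}, dyadicCube d p.1 p.2) ≤ 2 ^ (d * K) * 2⁻¹ ^ (d * J) := by
  have hcover : (⋃ p ∈ {p ∈ T | J < p.1}, dyadicCube d p.1 p.2) ⊆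
      ⋃ i : ℕ, ⋃ p ∈ T ∩ {p | p.1 = J + (i + 1)}, dyadicCube d p.1 p.2 := by
    refine iUnion₂_subset fun p hp => ?_
    obtain ⟨i, hi⟩ := Nat.exists_eq_add_of_lt hp.2
    exact (subset_biUnion_of_mem (u := fun p : ℕ × (Fin d → ℕ) => dyadicCube d p.1 p.2)
      (show p ∈ T ∩ {p | p.1 = J + (i + 1)} from ⟨hp.1, hi⟩)).trans
      (subset_iUnion (fun i : ℕ => ⋃ p ∈ T ∩ {p | p.1 = J + (i + 1)}, dyadicCube d p.1 p.2) i)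
  have hlevel : ∀ i : ℕ, lamd d (⋃ p ∈ T ∩ {p | p.1 = J + (i + 1)}, dyadicCube d p.1 p.2) ≤
      2 ^ (d * K) * 2⁻¹ ^ (d * J) * 2⁻¹ ^ (i + 1) := by
    intro i
    calc lamd d (⋃ p ∈ T ∩ {p | p.1 = J + (i + 1)}, dyadicCube d p.1 p.2)
        ≤ ∑' p : ↥(T ∩ {p | p.1 = J + (i + 1)}), lamd d (dyadicCube d p.1.1 p.1.2) :=
          measure_biUnion_le _ (to_countable _) _
      _ = ∑' p : ↥(T ∩ {p | p.1 = J + (i + 1)}), 2⁻¹ ^ (d * (J + (i + 1))) := by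
          refine tsum_congr fun p => ?_
          rw [lamd_dyadicCube (hT p p.2.1), p.2.2]
      _ ≤ 2 ^ (d * K) * 2⁻¹ ^ (d * (J + (i + 1))) := by
          rw [ENNReal.tsum_set_const]
          gcongr
          exact hcard _
      _ ≤ 2 ^ (d * K) * 2⁻¹ ^ (d * J) * 2⁻¹ ^ (i + 1) := by
          rw [mul_assoc, ← pow_add]
          gcongr 2 ^ (d * K) * ?_
          refine pow_le_pow_right_of_le_one' (by simp) ?_
          nlinarith
  calc lamd d (⋃ p ∈ {p ∈ T | J < p.1}, dyadicCube d p.1 p.2)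
      ≤ ∑' i : ℕ, lamd d (⋃ p ∈ T ∩ {p | p.1 = J + (i + 1)}, dyadicCube d p.1 p.2) :=
        (measure_mono hcover).trans (measure_iUnion_le _)
    _ ≤ ∑' i : ℕ, 2 ^ (d * K) * 2⁻¹ ^ (d * J) * 2⁻¹ ^ (i + 1) := ENNReal.tsum_le_tsum hlevel
    _ = 2 ^ (d * K) * 2⁻¹ ^ (d * J) := by
        rw [ENNReal.tsum_mul_left, ENNReal.tsum_geometric_add_one, ENNReal.one_sub_inv_two,
          ENNReal.mul_inv_cancel (by simp) (by simp), mul_one]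

/-! ### Majority vote on a cell -/

/-- The labels agreeing and disagreeing with the Bayes rule on a cell `I`, on which the Bayes rule
is constant, have masses separated by the margin. -/
lemma label_mass_bounds {d : ℕ} {π : Measure (Pt d × ℝ)} [IsProbabilityMeasure π]
    {η : Pt d → ℝ} {h : ℝ} (hlab : Labels π) (hreg : IsRegression π η) (hsma : SMAcond π η h)
    {I : Set (Pt d)} (hI : MeasurableSet I) {σ : ℝ} (hσ : ∀ x ∈ I, bayes η x = σ)
    (hσ1 : σ = 1 ∨ σ = -1) :
    (1 + h) / 2 * (margX π).real I ≤ π.real (I ×ˢ {σ}) ∧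
      π.real (I ×ˢ {-σ}) ≤ (1 - h) / 2 * (margX π).real I := by
  have hfst : Measurable (Prod.fst : Pt d × ℝ → Pt d) := measurable_fst
  have : IsProbabilityMeasure (margX π) := Measure.isProbabilityMeasure_map hfst.aemeasurable
  obtain ⟨hηm, hη01, hηint⟩ := hreg
  have hInt : Integrable η (margX π) :=
    Integrable.of_bound hηm.aestronglyMeasurable 1 (Filter.Eventually.of_forall fun x => by
      rw [Real.norm_of_nonneg (hη01 x).1]; exact (hη01 x).2)
  have hone : π.real (I ×ˢ {1}) = ∫ x in I, η x ∂(margX π) := by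
    rw [measureReal_def, hηint I hI, integral_eq_lintegral_of_nonneg_ae
      (Filter.Eventually.of_forall fun x => (hη01 x).1) hηm.aestronglyMeasurable]
  have hsum : π.real (I ×ˢ {1}) + π.real (I ×ˢ {-1}) = (margX π).real I := by
    have hdisj : Disjoint (I ×ˢ {(1 : ℝ)}) (I ×ˢ {(-1 : ℝ)}) := by
      refine Set.disjoint_left.2 fun z hz hz' => ?_
      have h1 : z.2 = 1 := hz.2
      have h2 : z.2 = -1 := hz'.2
      linarith
    rw [← measureReal_union hdisj (hI.prod (measurableSet_singleton _)), measureReal_def,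
      measureReal_def, margX, Measure.map_apply hfst hI]
    congr 1
    refine measure_congr ?_
    have hae : ∀ᵐ z ∂π, z.2 = 1 ∨ z.2 = -1 := by
      refine (mem_ae_iff_prob_eq_one ?_).2 hlab
      exact (measurable_snd (measurableSet_singleton _)).union
        (measurable_snd (measurableSet_singleton _))
    filter_upwards [hae] with z hz
    refine propext ?_
    change z ∈ I ×ˢ {(1 : ℝ)} ∪ I ×ˢ {(-1 : ℝ)} ↔ z ∈ Prod.fst ⁻¹' I
    simp only [mem_union, mem_prod, mem_singleton_iff, mem_preimage]
    tauto
  have hmargin : ∀ᵐ x ∂(margX π), h ≤ |2 * η x - 1| := by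
    refine (mem_ae_iff_prob_eq_one ?_).2 hsma
    exact measurableSet_le measurable_const (by fun_prop)
  have hconst : ∀ c : ℝ, ∫ _ in I, c ∂(margX π) = c * (margX π).real I := fun c => by
    rw [setIntegral_const, smul_eq_mul, mul_comm]
  have hci : ∀ c : ℝ, IntegrableOn (fun _ => c) I (margX π) := fun c => integrable_const c
  rcases hσ1 with rfl | rfl
  · have hlow : (1 + h) / 2 * (margX π).real I ≤ π.real (I ×ˢ {1}) := by
      rw [hone, ← hconst]
      refine setIntegral_mono_ae_restrict (hci _) hInt.integrableOn ?_
      filter_upwards [ae_restrict_of_ae hmargin, ae_restrict_mem hI] with x hx hxI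
      have hb := hσ x hxI
      unfold bayes at hb
      split_ifs at hb with h2
      · rw [abs_of_nonneg (by linarith)] at hx
        linarith
      · norm_num at hb
    exact ⟨hlow, by linarith⟩
  · have hupp : π.real (I ×ˢ {1}) ≤ (1 - h) / 2 * (margX π).real I := by
      rw [hone, ← hconst]
      refine setIntegral_mono_ae_restrict hInt.integrableOn (hci _) ?_
      filter_upwards [ae_restrict_of_ae hmargin, ae_restrict_mem hI] with x hx hxI
      have hb := hσ x hxI
      unfold bayes at hb
      split_ifs at hb with h2
      · norm_num at hb
      · rw [abs_of_nonpos (by linarith)] at hx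
        linarith
    exact ⟨by linarith, by simpa using hupp⟩

open Classical in
lemma cnt_eq_card (n : ℕ) (P : Fin n → Prop) : cnt n P = (Finset.univ.filter P).card := by
  rw [cnt, Nat.card_eq_fintype_card, Fintype.card_subtype]

/-- Exponential moment bound for the event that, among the sample points in `I`, the label `σ`
of the Bayes rule does not win the vote. -/
lemma exists_vote_bound {d : ℕ} {π : Measure (Pt d × ℝ)} [IsProbabilityMeasure π]
    {η : Pt d → ℝ} {h : ℝ} (hh : 0 < h) (hlab : Labels π) (hreg : IsRegression π η)
    (hsma : SMAcond π η h) {I : Set (Pt d)} (hI : MeasurableSet I) {σ : ℝ}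
    (hσ : ∀ x ∈ I, bayes η x = σ) (hσ1 : σ = 1 ∨ σ = -1) (n : ℕ) :
    ∃ g : (Fin n → Pt d × ℝ) → ℝ, Integrable g (sampM π n) ∧ (∀ s, 0 ≤ g s) ∧
      ∫ s, g s ∂(sampM π n) ≤ Real.exp (-(n * (h ^ 2 / 2 * (margX π).real I))) ∧
      ∀ s, cnt n (fun i => (s i).1 ∈ I ∧ (s i).2 = σ) ≤
        cnt n (fun i => (s i).1 ∈ I ∧ (s i).2 = -σ) → 1 ≤ g s := by
  classical
  have hr : 0 < 1 + h := by linarith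
  have hσne : σ ≠ -σ := by rcases hσ1 with rfl | rfl <;> norm_num
  set Z : Pt d × ℝ → ℝ := fun z =>
    (if z.1 ∈ I ∧ z.2 = -σ then 1 + h else 1) * (if z.1 ∈ I ∧ z.2 = σ then (1 + h)⁻¹ else 1)
    with hZ
  have hZ0 : ∀ z, 0 ≤ Z z := fun z => by
    rw [hZ]
    dsimp only
    split_ifs <;> positivity
  have hZind : Z = (fun _ => 1) + (I ×ˢ {-σ}).indicator (fun _ => h) +
      (I ×ˢ {σ}).indicator (fun _ => (1 + h)⁻¹ - 1) := by
    funext z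
    simp only [hZ, Pi.add_apply, indicator, mem_prod, mem_singleton_iff]
    split_ifs with h1 h2 h2
    · exact absurd (h2.2.symm.trans h1.2) hσne
    all_goals ring
  have hmσ : MeasurableSet (I ×ˢ {σ}) := hI.prod (measurableSet_singleton _)
  have hmσ' : MeasurableSet (I ×ˢ {-σ}) := hI.prod (measurableSet_singleton _)
  have hi1 : Integrable ((I ×ˢ {-σ}).indicator fun _ => h) π :=
    (integrable_const h).indicator hmσ'
  have hi2 : Integrable ((I ×ˢ {σ}).indicator fun _ => (1 + h)⁻¹ - 1) π :=
    (integrable_const _).indicator hmσ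
  have hZi : Integrable Z π := by
    rw [hZind]
    exact ((integrable_const _).add hi1).add hi2
  have hZint : ∫ z, Z z ∂π ≤ Real.exp (-(h ^ 2 / 2 * (margX π).real I)) := by
    obtain ⟨hright, hwrong⟩ := label_mass_bounds hlab hreg hsma hI hσ hσ1
    have hval : ∫ z, Z z ∂π =
        1 + π.real (I ×ˢ {-σ}) * h + π.real (I ×ˢ {σ}) * ((1 + h)⁻¹ - 1) := by
      rw [hZind, integral_add' ((integrable_const _).add hi1) hi2,
        integral_add' (integrable_const _) hi1, integral_indicator_const _ hmσ,
        integral_indicator_const _ hmσ']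
      simp
    have hinv : (1 + h)⁻¹ - 1 = -(h * (1 + h)⁻¹) := by
      field_simp
      ring
    have hstep : (1 + h) / 2 * (margX π).real I * (h * (1 + h)⁻¹) ≤
        π.real (I ×ˢ {σ}) * (h * (1 + h)⁻¹) := by gcongr
    have hcalc : (1 + h) / 2 * (margX π).real I * (h * (1 + h)⁻¹) =
        h / 2 * (margX π).real I := by
      field_simp
    refine le_trans ?_ (Real.add_one_le_exp _)
    rw [hval, hinv]
    nlinarith
  refine ⟨fun s => ∏ i, Z (s i), Integrable.fintype_prod fun _ => hZi,
    fun s => Finset.prod_nonneg fun i _ => hZ0 _, ?_, fun s hs => ?_⟩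
  · rw [sampM, integral_fintype_prod_eq_pow, Fintype.card_fin, ← mul_neg, Real.exp_nat_mul]
    exact pow_le_pow_left₀ (integral_nonneg hZ0) hZint n
  · rw [cnt_eq_card, cnt_eq_card] at hs
    simp only [hZ]
    rw [Finset.prod_mul_distrib, ← Finset.prod_filter, ← Finset.prod_filter, Finset.prod_const,
      Finset.prod_const, inv_pow, ← div_eq_mul_inv, one_le_div (by positivity)]
    exact pow_le_pow_right₀ (by linarith) (by convert hs)

/-- A wrong decision of the classifier on a cell means that the Bayes label lost the vote. -/
lemma cnt_le_of_fhat_ne {d J n : ℕ} {s : Fin n → Pt d × ℝ} {x : Pt d} {σ : ℝ}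
    (hσ1 : σ = 1 ∨ σ = -1) (hne : fhat d J n s x ≠ σ) :
    cnt n (fun i => (s i).1 ∈ cubeOf d J x ∧ (s i).2 = σ) ≤
      cnt n (fun i => (s i).1 ∈ cubeOf d J x ∧ (s i).2 = -σ) := by
  unfold fhat at hne
  rcases hσ1 with rfl | rfl
  · split_ifs at hne with hc
    · exact absurd rfl hne
    · by_contra! hlt
      refine hc ⟨?_, hlt⟩
      obtain ⟨⟨i, hi⟩⟩ := (Nat.card_pos_iff.1 (Nat.zero_lt_of_lt hlt)).1
      exact ⟨i, hi.1⟩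
  · rw [neg_neg]
    split_ifs at hne with hc
    · exact hc.2.le
    · exact absurd rfl hne

/-! ### Risk bounds -/

lemma isProbabilityMeasure_margX {d : ℕ} (π : Measure (Pt d × ℝ)) [IsProbabilityMeasure π] :
    IsProbabilityMeasure (margX π) :=
  Measure.isProbabilityMeasure_map measurable_fst.aemeasurable

lemma risk_le_add {d : ℕ} (π : Measure (Pt d × ℝ)) [IsProbabilityMeasure π]
    (f g : Pt d → ℝ) : risk π f ≤ risk π g + (margX π).real {x | f x ≠ g x} := by
  have := isProbabilityMeasure_margX π
  have hsub : {p : Pt d × ℝ | f p.1 ≠ p.2} ⊆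
      {p | g p.1 ≠ p.2} ∪ Prod.fst ⁻¹' {x | f x ≠ g x} := by
    intro p hp
    by_cases hg : g p.1 = p.2
    · exact Or.inr fun hfg => hp (hfg.trans hg)
    · exact Or.inl hg
  calc risk π f ≤ π.real ({p | g p.1 ≠ p.2} ∪ Prod.fst ⁻¹' {x | f x ≠ g x}) :=
        measureReal_mono hsub
    _ ≤ risk π g + π.real (Prod.fst ⁻¹' {x | f x ≠ g x}) := measureReal_union_le _ _
    _ ≤ risk π g + (margX π).real {x | f x ≠ g x} := by
        gcongr
        exact ENNReal.toReal_mono (measure_ne_top _ _)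
          (Measure.le_map_apply measurable_fst.aemeasurable _)

/-- The marginal mass of the points lying in no cube of level at most `J` of a dyadic
representation. -/
lemma margX_uncovered_le {d K : ℕ} (hd : 1 ≤ d) {π : Measure (Pt d × ℝ)} {a A : ℝ}
    (hA1 : A1cond π a A) {f : Pt d → ℝ} {T : Set (ℕ × (Fin d → ℕ))} (hT : IsDyadicRep d f T)
    (hcard : ∀ j, ((T ∩ {p | p.1 = j}).encard : ℝ≥0∞) ≤ 2 ^ (d * K)) (J : ℕ) :
    margX π {x | x ∈ unitCube d → ∀ p ∈ T, p.1 ≤ J → x ∉ dyadicCube d p.1 p.2} ≤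
      ENNReal.ofReal A * (2 ^ (d * K) * 2⁻¹ ^ (d * J)) := by
  obtain ⟨hidx, -, hfull, -⟩ := hT
  have hunit : MeasurableSet (unitCube d) := measurableSet_Icc
  have hmeas : ∀ S : Set (ℕ × (Fin d → ℕ)), MeasurableSet (⋃ p ∈ S, dyadicCube d p.1 p.2) :=
    fun S => MeasurableSet.biUnion (to_countable S) fun p _ => measurableSet_dyadicCube _ _ _
  set F : Set (Pt d) := ⋃ p ∈ {p ∈ T | J < p.1}, dyadicCube d p.1 p.2 with hF
  set N : Set (Pt d) := (unitCube d)ᶜ ∪ (unitCube d \ ⋃ p ∈ T, dyadicCube d p.1 p.2) with hN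
  have hNnull : lamd d N = 0 := by
    refine measure_union_null ?_ hfull
    rw [lamd, Measure.restrict_apply hunit.compl, compl_inter_self, measure_empty]
  have hsub : {x | x ∈ unitCube d → ∀ p ∈ T, p.1 ≤ J → x ∉ dyadicCube d p.1 p.2} ⊆ N ∪ F := by
    intro x hx
    by_cases hxU : x ∈ unitCube d
    · by_cases hxT : x ∈ ⋃ p ∈ T, dyadicCube d p.1 p.2
      · obtain ⟨p, hp, hxp⟩ := mem_iUnion₂.1 hxT
        exact Or.inr (mem_iUnion₂.2 ⟨p, ⟨hp, not_le.1 fun hle => hx hxU p hp hle hxp⟩, hxp⟩)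
      · exact Or.inl (Or.inr ⟨hxU, hxT⟩)
    · exact Or.inl (Or.inl hxU)
  calc _ ≤ margX π (N ∪ F) := measure_mono hsub
    _ ≤ ENNReal.ofReal A * lamd d (N ∪ F) :=
        (hA1 _ ((hunit.compl.union (hunit.diff (hmeas T))).union (hmeas _))).2
    _ ≤ ENNReal.ofReal A * (2 ^ (d * K) * 2⁻¹ ^ (d * J)) := by
        gcongr
        refine (measure_union_le _ _).trans ?_
        rw [hNnull, zero_add]
        exact lamd_fine_cubes_le hd hidx hcard J

/-- Approximation and estimation bound for the dyadic majority vote at level `J`. -/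
lemma excessExp_fhat_le {d K : ℕ} (hd : 1 ≤ d) {π : Measure (Pt d × ℝ)}
    [IsProbabilityMeasure π] {η : Pt d → ℝ} {h a A : ℝ} (hh : 0 < h) (ha : 0 < a) (hA : 0 ≤ A)
    (hlab : Labels π) (hreg : IsRegression π η) (hA1 : A1cond π a A) (hsma : SMAcond π η h)
    {T : Set (ℕ × (Fin d → ℕ))} (hT : IsDyadicRep d (bayes η) T)
    (hcard : ∀ j, ((T ∩ {p | p.1 = j}).encard : ℝ≥0∞) ≤ 2 ^ (d * K)) (J n : ℕ) :
    excessExp π η n (fhat d J n) ≤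
      A * (2 ^ (d * K) * 2⁻¹ ^ (d * J)) +
        A * Real.exp (-(n * (h ^ 2 / 2 * (a * 2⁻¹ ^ (d * J))))) := by
  classical
  have := isProbabilityMeasure_margX π
  have : IsProbabilityMeasure (sampM π n) := by unfold sampM; infer_instance
  set E : ℝ := Real.exp (-(n * (h ^ 2 / 2 * (a * 2⁻¹ ^ (d * J))))) with hE
  let cell : (Fin d → Fin (2 ^ J)) → Set (Pt d) := fun k => dyadicCube d J fun i => k i
  have hcellidx : ∀ (k : Fin d → Fin (2 ^ J)) (i : Fin d), (k i : ℕ) < 2 ^ J :=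
    fun k i => (k i).2
  have hcellmeas : ∀ k, MeasurableSet (cell k) := fun k => measurableSet_dyadicCube _ _ _
  have hcelllo : ∀ k, a * 2⁻¹ ^ (d * J) ≤ (margX π).real (cell k) := fun k => by
    have := ENNReal.toReal_mono (measure_ne_top _ _) (hA1 _ (hcellmeas k)).1
    rw [lamd_dyadicCube (hcellidx k)] at this
    simpa [measureReal_def, ENNReal.toReal_ofReal ha.le] using this
  have hcellup : ∀ k, (margX π).real (cell k) ≤ A * 2⁻¹ ^ (d * J) := fun k => by
    have hle := (hA1 _ (hcellmeas k)).2
    rw [lamd_dyadicCube (hcellidx k)] at hle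
    have := ENNReal.toReal_mono (ENNReal.mul_ne_top (by simp) (by simp)) hle
    simpa [measureReal_def, ENNReal.toReal_ofReal hA] using this
  have hvote : ∀ k, ∃ g : (Fin n → Pt d × ℝ) → ℝ, Integrable g (sampM π n) ∧ (∀ s, 0 ≤ g s) ∧
      ∫ s, g s ∂(sampM π n) ≤ E ∧
      ((∀ x ∈ cell k, ∀ y ∈ cell k, bayes η x = bayes η y) →
        ∀ s, ∀ x ∈ cell k, fhat d J n s x ≠ bayes η x → 1 ≤ g s) := by
    intro k
    by_cases hk : ∃ σ, (σ = 1 ∨ σ = -1) ∧ ∀ x ∈ cell k, bayes η x = σ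
    · obtain ⟨σ, hσ1, hσ⟩ := hk
      obtain ⟨g, hgi, hg0, hgint, hg⟩ :=
        exists_vote_bound hh hlab hreg hsma (hcellmeas k) hσ hσ1 n
      refine ⟨g, hgi, hg0, hgint.trans ?_, fun _ s x hx hne => hg s ?_⟩
      · rw [hE]
        gcongr
        exact hcelllo k
      · rw [hσ x hx] at hne
        have := cnt_le_of_fhat_ne hσ1 hne
        rwa [cubeOf_eq (hcellidx k) hx] at this
    · refine ⟨0, integrable_zero _ _ _, fun _ => le_rfl, ?_, fun hconst s x hx _ => ?_⟩
      · simpa using (Real.exp_pos _).le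
      · refine absurd ⟨bayes η x, ?_, fun y hy => hconst y hy x hx⟩ hk
        unfold bayes
        split_ifs <;> simp
  choose g hgi hg0 hgint hg using hvote
  have hpoint : ∀ s, risk π (fhat d J n s) ≤
      risk π (bayes η) + A * (2 ^ (d * K) * 2⁻¹ ^ (d * J)) +
        ∑ k, A * 2⁻¹ ^ (d * J) * g k s := by
    intro s
    set U : Set (Pt d) :=
      {x | x ∈ unitCube d → ∀ p ∈ T, p.1 ≤ J → x ∉ dyadicCube d p.1 p.2} with hU
    have hUle : (margX π).real U ≤ A * (2 ^ (d * K) * 2⁻¹ ^ (d * J)) := by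
      have hle := margX_uncovered_le hd hA1 hT hcard J
      rw [← hU] at hle
      have := ENNReal.toReal_mono (by
        refine ENNReal.mul_ne_top (by simp) (ENNReal.mul_ne_top ?_ ?_) <;> simp) hle
      simpa [measureReal_def, ENNReal.toReal_ofReal hA] using this
    let W : Finset (Fin d → Fin (2 ^ J)) := Finset.univ.filter fun k => 1 ≤ g k s
    have hsub : {x | fhat d J n s x ≠ bayes η x} ⊆ U ∪ ⋃ k ∈ W, cell k := by
      intro x hx
      by_cases hxU : x ∈ U
      · exact Or.inl hxU
      · refine Or.inr ?_
        simp only [hU, mem_ofPred_eq, not_forall, not_not] at hxU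
        obtain ⟨hx1, p, hp, hpJ, hxp⟩ := hxU
        let k : Fin d → Fin (2 ^ J) := fun i => ⟨dyadicIdx J (x i), dyadicIdx_lt J (x i)⟩
        have hxk : x ∈ cell k := (mem_dyadicCube_iff (hcellidx k) x).2 ⟨hx1, fun _ => rfl⟩
        have hsubp := dyadicCube_subset hpJ (hT.1 p hp) (hcellidx k) hxp hxk
        refine mem_iUnion₂.2 ⟨k, Finset.mem_filter.2 ⟨Finset.mem_univ _, ?_⟩, hxk⟩
        exact hg k (fun y hy z hz => hT.2.2.2 p hp y (hsubp hy) z (hsubp hz)) s x hxk hx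
    have hWle : (margX π).real (⋃ k ∈ W, cell k) ≤ ∑ k, A * 2⁻¹ ^ (d * J) * g k s := by
      calc (margX π).real (⋃ k ∈ W, cell k) ≤ ∑ k ∈ W, (margX π).real (cell k) :=
            measureReal_biUnion_finset_le _ _
        _ ≤ ∑ k ∈ W, A * 2⁻¹ ^ (d * J) * g k s := by
            refine Finset.sum_le_sum fun k hk => (hcellup k).trans ?_
            exact le_mul_of_one_le_right (by positivity) (Finset.mem_filter.1 hk).2
        _ ≤ ∑ k, A * 2⁻¹ ^ (d * J) * g k s :=
            Finset.sum_le_sum_of_subset_of_nonneg (Finset.subset_univ _)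
              fun k _ _ => mul_nonneg (by positivity) (hg0 k s)
    have hle : (margX π).real {x | fhat d J n s x ≠ bayes η x} ≤
        (margX π).real U + (margX π).real (⋃ k ∈ W, cell k) :=
      (measureReal_mono hsub).trans (measureReal_union_le _ _)
    linarith [risk_le_add π (fhat d J n s) (bayes η)]
  have hsumi : Integrable (fun s => ∑ k, A * 2⁻¹ ^ (d * J) * g k s) (sampM π n) :=
    integrable_finsetSum _ fun k _ => (hgi k).const_mul _
  have hInt : ∫ s, risk π (fhat d J n s) ∂(sampM π n) ≤
      ∫ s, (risk π (bayes η) + A * (2 ^ (d * K) * 2⁻¹ ^ (d * J)) +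
        ∑ k, A * 2⁻¹ ^ (d * J) * g k s) ∂(sampM π n) :=
    integral_mono_of_nonneg (Filter.Eventually.of_forall fun _ => ENNReal.toReal_nonneg)
      ((integrable_const _).add hsumi) (Filter.Eventually.of_forall hpoint)
  rw [integral_add (integrable_const _) hsumi, integral_const, probReal_univ, one_smul,
    integral_finsetSum _ fun k _ => (hgi k).const_mul _] at hInt
  have hsumle : ∑ k, ∫ s, A * 2⁻¹ ^ (d * J) * g k s ∂(sampM π n) ≤ A * E := by
    calc ∑ k, ∫ s, A * 2⁻¹ ^ (d * J) * g k s ∂(sampM π n)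
        ≤ ∑ _k : Fin d → Fin (2 ^ J), A * 2⁻¹ ^ (d * J) * E := by
          refine Finset.sum_le_sum fun k _ => ?_
          rw [integral_const_mul]
          exact mul_le_mul_of_nonneg_left (hgint k) (by positivity)
      _ = A * E := by
          rw [Finset.sum_const, Finset.card_univ, Fintype.card_fun, Fintype.card_fin,
            Fintype.card_fin, nsmul_eq_mul, inv_pow, mul_comm d J, pow_mul]
          push_cast
          field_simp
  unfold excessExp
  linarith

lemma excessExp_le_one {d : ℕ} (π : Measure (Pt d × ℝ)) [IsProbabilityMeasure π]
    (η : Pt d → ℝ) (n : ℕ) (F : (Fin n → Pt d × ℝ) → Pt d → ℝ) : excessExp π η n F ≤ 1 := by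
  have : IsProbabilityMeasure (sampM π n) := by unfold sampM; infer_instance
  have hInt : ∫ s, risk π (F s) ∂(sampM π n) ≤ ∫ _, (1 : ℝ) ∂(sampM π n) :=
    integral_mono_of_nonneg (Filter.Eventually.of_forall fun _ => ENNReal.toReal_nonneg)
      (integrable_const _) (Filter.Eventually.of_forall fun _ => measureReal_le_one)
  have hrisk : 0 ≤ risk π (bayes η) := ENNReal.toReal_nonneg
  simp only [integral_const, probReal_univ, one_smul] at hInt
  unfold excessExp
  linarith

/-- **Fast rate for the truncated class, upper bound.** On
`P_K^(d) = P_{w_K,h,a,A}` the dyadic majority-vote classifier at suitable levels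
`J_n` attains the rate `(log n)/n`. -/
theorem truncated_class_upper_bound (d K : ℕ) (hd : 1 ≤ d) (hK : 1 ≤ K)
    (h a A : ℝ) (hh : 0 < h) (hh1 : h ≤ 1) (ha : 0 < a) (ha1 : a ≤ 1) (hA : 1 ≤ A) :
    ∃ C : ℝ, 0 < C ∧ ∃ Jn : ℕ → ℕ, ∀ n : ℕ, 3 ≤ n →
      ∀ p : ProbabilityMeasure (Pt d × ℝ) × (Pt d → ℝ),
        p ∈ Pclass d (fun j => if j ≤ K then (2 : ℝ) ^ (d * j) else (2 : ℝ) ^ (d * K)) h a A →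
          excessExp (p.1 : Measure (Pt d × ℝ)) p.2 n (fhat d (Jn n) n) ≤
            C * Real.log n / n := by
  set B : ℝ := a * h ^ 2 / 2 with hB
  have hBpos : 0 < B := by positivity
  refine ⟨A * 2 ^ (d * K) * 2 ^ d / B + A, by positivity,
    fun n => Nat.log (2 ^ d) ⌊B * n / Real.log n⌋₊, fun n hn p hp => ?_⟩
  obtain ⟨hlab, hreg, hA1, hsma, -, -, T, hT, hTw⟩ := hp
  have hcard : ∀ j, ((T ∩ {p | p.1 = j}).encard : ℝ≥0∞) ≤ 2 ^ (d * K) := by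
    intro j
    have hw : (if j ≤ K then (2 : ℝ) ^ (d * j) else 2 ^ (d * K)) ≤ 2 ^ (d * K) := by
      split_ifs with hj
      · exact pow_le_pow_right₀ (by norm_num) (Nat.mul_le_mul_left d hj)
      · exact le_rfl
    refine (hTw j).trans ((ENNReal.ofReal_le_ofReal hw).trans ?_)
    rw [ENNReal.ofReal_pow (by norm_num), ENNReal.ofReal_ofNat]
  have hn0 : (0 : ℝ) < n := by positivity
  have hlog1 : 1 ≤ Real.log n := by
    rw [Real.le_log_iff_exp_le hn0]
    exact Real.exp_one_lt_three.le.trans (by exact_mod_cast hn)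
  have hlog0 : 0 < Real.log n := by linarith
  set x : ℝ := B * n / Real.log n with hx
  have hx0 : 0 < x := by positivity
  have hxinv : Real.log n / n = B / x := by
    rw [hx]
    field_simp
  rcases lt_or_ge x 1 with hx1 | hx1
  · refine (excessExp_le_one _ _ _ _).trans ?_
    have hone : 1 ≤ (A * 2 ^ (d * K) * 2 ^ d / B + A) * B := by
      have h1 : (1 : ℝ) ≤ 2 ^ (d * K) := one_le_pow₀ (by norm_num)
      have h2 : (1 : ℝ) ≤ 2 ^ d := one_le_pow₀ (by norm_num)
      have h3 : 1 ≤ A * 2 ^ (d * K) * 2 ^ d :=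
        one_le_mul_of_one_le_of_one_le (one_le_mul_of_one_le_of_one_le hA h1) h2
      rw [add_mul, div_mul_cancel₀ _ hBpos.ne']
      nlinarith
    rw [mul_div_assoc, hxinv, ← mul_div_assoc, le_div_iff₀ hx0]
    linarith
  · set J : ℕ := Nat.log (2 ^ d) ⌊x⌋₊ with hJ
    have hfloor : ⌊x⌋₊ ≠ 0 := (Nat.floor_pos.2 hx1).ne'
    have hJle : (2 : ℝ) ^ (d * J) ≤ x := by
      have hpow := Nat.pow_log_le_self (2 ^ d) hfloor
      rw [← hJ, ← pow_mul] at hpow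
      exact (by exact_mod_cast hpow : (2 : ℝ) ^ (d * J) ≤ ⌊x⌋₊).trans (Nat.floor_le hx0.le)
    have hJlt : x < 2 ^ (d * J) * 2 ^ d := by
      have hpow := Nat.lt_pow_succ_log_self (Nat.one_lt_two_pow (by omega : d ≠ 0)) ⌊x⌋₊
      rw [← hJ, Nat.succ_eq_add_one, ← pow_mul] at hpow
      rw [← pow_add, ← mul_add_one]
      exact_mod_cast (Nat.floor_lt hx0.le).1 hpow
    have hpos : (0 : ℝ) < 2 ^ (d * J) := by positivity
    refine (excessExp_fhat_le hd hh ha (by linarith) hlab hreg hA1 hsma hT hcard J n).trans ?_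
    have happrox : (2⁻¹ : ℝ) ^ (d * J) ≤ 2 ^ d / B * (Real.log n / n) := by
      have heq : 2 ^ d / B * (B / x) = 2 ^ d / x := by field_simp
      rw [inv_pow, hxinv, heq, inv_le_comm₀ hpos (by positivity), inv_div,
        div_le_iff₀ (by positivity)]
      exact hJlt.le
    have hest : Real.exp (-(n * (h ^ 2 / 2 * (a * 2⁻¹ ^ (d * J))))) ≤ Real.log n / n := by
      have hexponent : Real.log n ≤ n * (h ^ 2 / 2 * (a * 2⁻¹ ^ (d * J))) := by
        have heq : n * (h ^ 2 / 2 * (a * 2⁻¹ ^ (d * J))) = B * n / (2 : ℝ) ^ (d * J) := by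
          rw [hB, inv_pow]
          field_simp
        rw [heq, le_div_iff₀ hpos]
        rw [hx, le_div_iff₀ hlog0] at hJle
        linarith
      calc Real.exp (-(n * (h ^ 2 / 2 * (a * 2⁻¹ ^ (d * J))))) ≤ Real.exp (-Real.log n) :=
            Real.exp_le_exp.2 (neg_le_neg hexponent)
        _ = 1 / n := by rw [Real.exp_neg, Real.exp_log hn0, one_div]
        _ ≤ Real.log n / n := by gcongr
    calc A * (2 ^ (d * K) * 2⁻¹ ^ (d * J)) +
          A * Real.exp (-(n * (h ^ 2 / 2 * (a * 2⁻¹ ^ (d * J)))))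
        ≤ A * (2 ^ (d * K) * (2 ^ d / B * (Real.log n / n))) + A * (Real.log n / n) := by
          gcongr
      _ = (A * 2 ^ (d * K) * 2 ^ d / B + A) * Real.log n / n := by ring
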